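/- Let H_1 and H_2 be non-null tournaments, and let H = H_1 ⇒ H_2. Let m = max(|V(H_1)|, |V(H_2)|) and 𝓕 = {H_1, H_2}. Then every H-free tournament G admits an (𝓕, 2(m+1)^m)-partition. -/

import Mathlib

/-- A tournament on `V`: for every two distinct vertices exactly one of the two
directed edges is present, and there are no loops. -/
structure Tournament (V : Type) where
  adj : V → V → Prop
  irrefl : ∀ v, ¬ adj v v
  exactlyOne : ∀ u v, u ≠ v → (adj u v ↔ ¬ adj v u)

/-- The subtournament induced on a subset `X` of the vertices. -/
def Tournament.induce {V : Type} (G : Tournament V) (X : Set V) : Tournament X where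
  adj a b := G.adj a b
  irrefl v := G.irrefl v
  exactlyOne u v h := G.exactlyOne u v (fun hc => h (Subtype.ext hc))

/-- `G` contains `H` if `H` is isomorphic to a subtournament of `G`. -/
def TContains {α β : Type} (G : Tournament α) (H : Tournament β) : Prop :=
  ∃ f : β → α, Function.Injective f ∧ ∀ u v, H.adj u v ↔ G.adj (f u) (f v)

/-- `H₁ ⇒ H₂`: the tournament on the disjoint union of the vertex sets in which every
vertex of `H₁` is adjacent to every vertex of `H₂`. -/
def TSeq {α β : Type} (H₁ : Tournament α) (H₂ : Tournament β) : Tournament (α ⊕ β) where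
  adj x y := match x, y with
    | Sum.inl a, Sum.inl b => H₁.adj a b
    | Sum.inr a, Sum.inr b => H₂.adj a b
    | Sum.inl _, Sum.inr _ => True
    | Sum.inr _, Sum.inl _ => False
  irrefl v := by cases v with
    | inl a => exact H₁.irrefl a
    | inr a => exact H₂.irrefl a
  exactlyOne u v h := by
    cases u with
    | inl a => cases v with
      | inl b => exact H₁.exactlyOne a b (fun hc => h (congrArg Sum.inl hc))
      | inr b => simp
    | inr a => cases v with
      | inl b => simp
      | inr b => exact H₂.exactlyOne a b (fun hc => h (congrArg Sum.inr hc))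

/-- The vertex type `γ` can be partitioned into `P` subsets each of which is a singleton
or satisfies the predicate `Ok`. -/
def HasPartition {γ : Type} (P : ℕ) (Ok : Set γ → Prop) : Prop :=
  ∃ X : Fin P → Set γ, (⋃ i, X i) = Set.univ ∧
    (Pairwise fun i j => Disjoint (X i) (X j)) ∧
    ∀ i, (∃ v, X i = {v}) ∨ Ok (X i)

theorem tContains_tSeq {α β γ : Type} {H₁ : Tournament α} {H₂ : Tournament β}
    {G : Tournament γ} {f : α → γ} {g : β → γ} (hf : f.Injective) (hg : g.Injective)
    (hfa : ∀ a b, H₁.adj a b ↔ G.adj (f a) (f b)) (hga : ∀ a b, H₂.adj a b ↔ G.adj (g a) (g b))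
    (hfg : ∀ a b, G.adj (f a) (g b)) : TContains G (TSeq H₁ H₂) := by
  have hne : ∀ a b, f a ≠ g b := fun a b h => G.irrefl (g b) (h ▸ hfg a b)
  refine ⟨Sum.elim f g, hf.sumElim hg hne, ?_⟩
  rintro (a | a) (b | b)
  · exact hfa a b
  · simp [TSeq, hfg a b]
  · simpa [TSeq] using (G.exactlyOne _ _ (hne b a)).1 (hfg b a)
  · exact hga a b

theorem tContains_induce_iff {α γ : Type} {G : Tournament γ} {H : Tournament α} {X : Set γ} :
    TContains (G.induce X) H ↔
      ∃ f : α → γ, f.Injective ∧ (∀ a, f a ∈ X) ∧ ∀ a b, H.adj a b ↔ G.adj (f a) (f b) := by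
  constructor
  · rintro ⟨f, hf, hadj⟩
    exact ⟨fun a => f a, Subtype.val_injective.comp hf, fun a => (f a).2, hadj⟩
  · rintro ⟨f, hf, hX, hadj⟩
    exact ⟨fun a => ⟨f a, hX a⟩, fun a b h => hf (congrArg Subtype.val h), hadj⟩

theorem TContains.mono_induce {α γ : Type} {G : Tournament γ} {H : Tournament α} {X Y : Set γ}
    (h : X ⊆ Y) (hX : TContains (G.induce X) H) : TContains (G.induce Y) H := by
  rw [tContains_induce_iff] at hX ⊢
  obtain ⟨f, hf, hfX, hadj⟩ := hX
  exact ⟨f, hf, fun a => h (hfX a), hadj⟩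

/-- A set of vertices allowed as a part of a partition, empty sets included. -/
def IsPart {α β γ : Type} (H₁ : Tournament α) (H₂ : Tournament β) (G : Tournament γ)
    (X : Set γ) : Prop :=
  X.Subsingleton ∨ ¬ TContains (G.induce X) H₁ ∨ ¬ TContains (G.induce X) H₂

/-- `X` can be split into at most `k` parts. -/
def Splits {α β γ : Type} (H₁ : Tournament α) (H₂ : Tournament β) (G : Tournament γ)
    (k : ℕ) (X : Set γ) : Prop :=
  ∃ c : γ → ℕ, (∀ x ∈ X, c x < k) ∧ ∀ i, IsPart H₁ H₂ G {x ∈ X | c x = i}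

section Splits

variable {α β γ : Type} {H₁ : Tournament α} {H₂ : Tournament β} {G : Tournament γ}
  {X Y : Set γ} {k l : ℕ}

theorem IsPart.mono (h : X ⊆ Y) (hY : IsPart H₁ H₂ G Y) : IsPart H₁ H₂ G X := by
  rcases hY with hY | hY | hY
  · exact Or.inl (hY.anti h)
  · exact Or.inr (Or.inl fun hX => hY (hX.mono_induce h))
  · exact Or.inr (Or.inr fun hX => hY (hX.mono_induce h))

theorem Splits.mono (h : X ⊆ Y) (hkl : k ≤ l) (hY : Splits H₁ H₂ G k Y) :
    Splits H₁ H₂ G l X := by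
  obtain ⟨c, hc, hp⟩ := hY
  refine ⟨c, fun x hx => (hc x (h hx)).trans_le hkl, fun i => (hp i).mono ?_⟩
  exact fun x hx => ⟨h hx.1, hx.2⟩

theorem splits_empty : Splits H₁ H₂ G k ∅ :=
  ⟨fun _ => 0, by simp, fun i => Or.inl (by simp)⟩

theorem IsPart.splits (h : IsPart H₁ H₂ G X) : Splits H₁ H₂ G 1 X :=
  ⟨fun _ => 0, by simp, fun i => h.mono fun x hx => hx.1⟩

theorem Splits.union (hX : Splits H₁ H₂ G k X) (hY : Splits H₁ H₂ G l Y) :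
    Splits H₁ H₂ G (k + l) (X ∪ Y) := by
  classical
  obtain ⟨c, hc, hp⟩ := hX
  obtain ⟨d, hd, hq⟩ := hY
  refine ⟨fun x => if x ∈ X then c x else k + d x, ?_, fun i => ?_⟩
  · intro x hx
    by_cases h : x ∈ X
    · have := hc x h
      simp only [h, if_true]
      omega
    · have := hd x (hx.resolve_left h)
      simp only [h, if_false]
      omega
  · rcases lt_or_ge i k with hi | hi
    · refine (hp i).mono ?_
      rintro x ⟨hx, hxi⟩
      by_cases h : x ∈ X
      · exact ⟨h, by simpa [h] using hxi⟩
      · simp only [h, if_false] at hxi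
        omega
    · refine (hq (i - k)).mono ?_
      rintro x ⟨hx, hxi⟩
      by_cases h : x ∈ X
      · have := hc x h
        simp only [h, if_true] at hxi
        omega
      · refine ⟨hx.resolve_left h, ?_⟩
        simp only [h, if_false] at hxi
        omega

theorem Splits.biUnion {ι : Type} (s : Finset ι) (F : ι → Set γ)
    (h : ∀ i ∈ s, Splits H₁ H₂ G k (F i)) : Splits H₁ H₂ G (s.card * k) (⋃ i ∈ s, F i) := by
  classical
  induction s using Finset.induction_on with
  | empty => simpa using splits_empty
  | insert a s ha ih =>
    have h₁ := (h a (by simp)).union (ih fun i hi => h i (by simp [hi]))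
    rw [Finset.card_insert_of_notMem ha, Finset.set_biUnion_insert]
    exact h₁.mono subset_rfl (by ring_nf; rfl)

/-- A set needing many parts contains disjoint subsets sharing out that number. -/
theorem exists_subset_of_not_splits [Finite γ] (h : ¬ Splits H₁ H₂ G (k + 1 + l) X) :
    ∃ Y ⊆ X, ¬ Splits H₁ H₂ G k Y ∧ ¬ Splits H₁ H₂ G l (X \ Y) := by
  have hX : ¬ Splits H₁ H₂ G k X := fun hX => h (hX.mono subset_rfl (by omega))
  obtain ⟨Y, hYX, hY⟩ :=
    exists_minimal_le_of_wellFoundedLT (fun Z => ¬ Splits H₁ H₂ G k Z) X hX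
  refine ⟨Y, hYX, hY.prop, fun hl => h ?_⟩
  obtain ⟨y, hy⟩ : Y.Nonempty := by
    rw [Set.nonempty_iff_ne_empty]
    rintro rfl
    exact hY.prop splits_empty
  have hYy : Splits H₁ H₂ G k (Y \ {y}) := by
    by_contra hn
    exact (hY.le_of_le hn Set.sdiff_subset hy).2 rfl
  have hy1 : Splits H₁ H₂ G 1 {y} := IsPart.splits (Or.inl Set.subsingleton_singleton)
  refine ((hYy.union hy1).union hl).mono (fun x hx => ?_) le_rfl
  by_cases hxY : x ∈ Y <;> by_cases hxy : x = y <;> simp [hx, hxY, hxy]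

theorem exists_disjoint_of_not_splits [Finite γ] (n : ℕ) (d : ℕ → ℕ) (X : Set γ)
    (h : ¬ Splits H₁ H₂ G (∑ i ∈ Finset.range n, (d i + 1) + d n) X) :
    ∃ U : ℕ → Set γ, (∀ i ≤ n, U i ⊆ X) ∧ (∀ i ≤ n, ¬ Splits H₁ H₂ G (d i) (U i)) ∧
      ∀ i j, i < j → j ≤ n → Disjoint (U i) (U j) := by
  induction n generalizing d X with
  | zero => exact ⟨fun _ => X, by simp, by simpa using h, by omega⟩
  | succ n ih =>
    rw [Finset.sum_range_succ'] at h
    obtain ⟨Y, hYX, hY, hrest⟩ := exists_subset_of_not_splits (k := d 0)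
      (l := ∑ i ∈ Finset.range n, (d (i + 1) + 1) + d (n + 1)) (X := X)
      (fun hs => h (hs.mono subset_rfl (by omega)))
    obtain ⟨U, hUX, hU, hdisj⟩ := ih (fun i => d (i + 1)) (X \ Y) hrest
    refine ⟨fun i => Nat.casesOn i Y U, ?_, ?_, ?_⟩
    · rintro (_ | i) hi
      · exact hYX
      · exact (hUX i (by omega)).trans Set.sdiff_subset
    · rintro (_ | i) hi
      · exact hY
      · exact hU i (by omega)
    · rintro (_ | i) (_ | j) hij hj
      · omega
      · exact Set.disjoint_sdiff_right.mono_right (hUX j (by omega))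
      · omega
      · exact hdisj i j (by omega) (by omega)

/-- In an `H₁ ⇒ H₂`-free tournament, the vertices with few out-neighbours (or few in-neighbours)
in a large disjoint set form a single part. -/
theorem isPart_of_splits_neighbors [Fintype α] [Fintype β] {m t : ℕ}
    (hα : Fintype.card α ≤ m) (hβ : Fintype.card β ≤ m)
    (hG : ¬ TContains G (TSeq H₁ H₂)) (p : Prop) {S U : Set γ} (hSU : Disjoint S U)
    (hU : ¬ Splits H₁ H₂ G (m * t + 1) U)
    (hS : ∀ v ∈ S, Splits H₁ H₂ G t {u ∈ U | p ↔ G.adj v u}) : IsPart H₁ H₂ G S := by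
  by_cases hp : p
  · refine Or.inr (Or.inr fun hc => hU ?_)
    obtain ⟨g, hg, hgS, hga⟩ := tContains_induce_iff.1 hc
    have h₁ := Splits.biUnion Finset.univ (fun b => {u ∈ U | p ↔ G.adj (g b) u})
      fun b _ => hS (g b) (hgS b)
    have h₂ : IsPart H₁ H₂ G {u ∈ U | ∀ b, ¬ G.adj (g b) u} := by
      refine Or.inr (Or.inl fun hc => ?_)
      obtain ⟨f, hf, hfU, hfa⟩ := tContains_induce_iff.1 hc
      refine hG (tContains_tSeq hf hg hfa hga fun a b => ?_)
      exact (G.exactlyOne _ _ (hSU.ne_of_mem (hgS b) (hfU a).1).symm).2 ((hfU a).2 b)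
    refine (h₁.union h₂.splits).mono (fun u hu => ?_)
      (Nat.add_le_add_right (Nat.mul_le_mul_right t hβ) 1)
    by_cases h : ∃ b, G.adj (g b) u
    · obtain ⟨b, hb⟩ := h
      exact Or.inl (by simp only [Set.mem_iUnion]; exact ⟨b, by simp, hu, by simp [hp, hb]⟩)
    · exact Or.inr ⟨hu, not_exists.1 h⟩
  · refine Or.inr (Or.inl fun hc => hU ?_)
    obtain ⟨f, hf, hfS, hfa⟩ := tContains_induce_iff.1 hc
    have h₁ := Splits.biUnion Finset.univ (fun a => {u ∈ U | p ↔ G.adj (f a) u})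
      fun a _ => hS (f a) (hfS a)
    have h₂ : IsPart H₁ H₂ G {u ∈ U | ∀ a, G.adj (f a) u} := by
      refine Or.inr (Or.inr fun hc => ?_)
      obtain ⟨g, hg, hgU, hga⟩ := tContains_induce_iff.1 hc
      exact hG (tContains_tSeq hf hg hfa hga fun a b => (hgU b).2 a)
    refine (h₁.union h₂.splits).mono (fun u hu => ?_)
      (Nat.add_le_add_right (Nat.mul_le_mul_right t hα) 1)
    by_cases h : ∃ a, ¬ G.adj (f a) u
    · obtain ⟨a, ha⟩ := h
      exact Or.inl (by simp only [Set.mem_iUnion]; exact ⟨a, by simp, hu, by simp [hp, ha]⟩)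
    · exact Or.inr ⟨hu, by simpa using h⟩

/-- Greedy embedding: vertices with prescribed adjacencies can be chosen in disjoint large sets,
keeping a prescribed common neighbourhood in the last set large. -/
theorem exists_greedy_embedding [Fintype α] [Fintype β] {m : ℕ}
    (hα : Fintype.card α ≤ m) (hβ : Fintype.card β ≤ m)
    (hG : ¬ TContains G (TSeq H₁ H₂)) (n : ℕ) (R : ℕ → ℕ → Prop) (U : ℕ → Set γ)
    (hU : ∀ i ≤ n, ¬ Splits H₁ H₂ G (max (n - i) 1 * (m + 1) ^ i) (U i))
    (hdisj : ∀ i j, i < j → j ≤ n → Disjoint (U i) (U j)) :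
    ∃ f : ℕ → γ, (∀ i < n, f i ∈ U i) ∧
      (∀ i j, i < j → j < n → (R i j ↔ G.adj (f i) (f j))) ∧
      ¬ Splits H₁ H₂ G 1 {u ∈ U n | ∀ i < n, R i n ↔ G.adj (f i) u} := by
  induction n generalizing R U with
  | zero =>
    have h0 := hU 0 le_rfl
    obtain ⟨x, -⟩ : (U 0).Nonempty := by
      rw [Set.nonempty_iff_ne_empty]
      intro h
      rw [h] at h0
      exact h0 splits_empty
    exact ⟨fun _ => x, by simp, by simp, by simpa using h0⟩
  | succ n ih =>
    obtain ⟨v, hv, hgood⟩ : ∃ v ∈ U 0, ∀ i ≤ n, ¬ Splits H₁ H₂ G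
        (max (n - i) 1 * (m + 1) ^ i) {u ∈ U (i + 1) | R 0 (i + 1) ↔ G.adj v u} := by
      by_contra! hbad
      have hS : ∀ i ∈ Finset.range (n + 1), Splits H₁ H₂ G 1 {v ∈ U 0 | Splits H₁ H₂ G
          (max (n - i) 1 * (m + 1) ^ i) {u ∈ U (i + 1) | R 0 (i + 1) ↔ G.adj v u}} := by
        intro i hi
        have hi : i ≤ n := by simpa [Nat.lt_succ_iff] using hi
        refine (isPart_of_splits_neighbors hα hβ hG (R 0 (i + 1))
          ((hdisj 0 (i + 1) (by omega) (by omega)).mono_left fun v hv => hv.1) ?_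
          fun v hv => hv.2).splits
        refine fun hs => hU (i + 1) (by omega) (hs.mono subset_rfl ?_)
        have hpos : 1 ≤ max (n - i) 1 * (m + 1) ^ i :=
          Nat.mul_pos (by omega) (by positivity)
        rw [Nat.add_sub_add_right, pow_succ]
        nlinarith
      refine hU 0 (by omega) ((Splits.biUnion _ _ hS).mono (fun v hv => ?_) (by simp))
      obtain ⟨i, hi, hs⟩ := hbad v hv
      simp only [Set.mem_iUnion]
      exact ⟨i, by simpa [Nat.lt_succ_iff] using hi, hv, hs⟩
    obtain ⟨f, hfU, hfR, hlast⟩ := ih (fun i j => R (i + 1) (j + 1))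
      (fun i => {u ∈ U (i + 1) | R 0 (i + 1) ↔ G.adj v u}) hgood fun i j hij hj =>
        (hdisj (i + 1) (j + 1) (by omega) (by omega)).mono (fun _ h => h.1) fun _ h => h.1
    refine ⟨fun i => Nat.casesOn i v f, ?_, ?_, fun hs => hlast (hs.mono ?_ le_rfl)⟩
    · rintro (_ | i) hi
      · exact hv
      · exact (hfU i (by omega)).1
    · rintro (_ | i) (_ | j) hij hj
      · omega
      · exact (hfU j (by omega)).2
      · omega
      · exact hfR i j (by omega) (by omega)
    · rintro u ⟨⟨hu, hvu⟩, hfu⟩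
      refine ⟨hu, ?_⟩
      rintro (_ | i) hi
      · exact hvu
      · exact hfu i (by omega)

end Splits

theorem sum_range_sub_mul_pow_le {n m : ℕ} (hnm : n ≤ m) :
    ∑ i ∈ Finset.range n, (max (n - i) 1 * (m + 1) ^ i + 1) ≤ (m + 1) ^ n := by
  suffices h : ∀ k ≤ n,
      ∑ i ∈ Finset.range k, (max (n - i) 1 * (m + 1) ^ i + 1) ≤ (m + 1) ^ k from h n le_rfl
  intro k hk
  induction k with
  | zero => simp
  | succ k ih =>
    rw [Finset.sum_range_succ]
    rcases Nat.eq_zero_or_pos k with rfl | hpos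
    · simp only [Finset.sum_range_zero, pow_zero, zero_add, pow_one]
      omega
    · have h₁ := ih (by omega)
      have h₂ : max (n - k) 1 + 1 ≤ m := by omega
      have h₃ : 1 ≤ (m + 1) ^ k := Nat.one_le_pow _ _ (by omega)
      have h₄ := Nat.mul_le_mul_right ((m + 1) ^ k) h₂
      rw [pow_succ]
      nlinarith

theorem splits_univ_of_not_tContains {α β γ : Type} [Fintype α] [Fintype β] [Finite γ]
    {H₁ : Tournament α} {H₂ : Tournament β} {G : Tournament γ} {m : ℕ}
    (hα : Fintype.card α ≤ m) (hβ : Fintype.card β ≤ m)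
    (hG : ¬ TContains G (TSeq H₁ H₂)) : Splits H₁ H₂ G (2 * (m + 1) ^ m) Set.univ := by
  by_contra hbig
  obtain ⟨U, -, hU, hdisj⟩ := exists_disjoint_of_not_splits (H₁ := H₁) (H₂ := H₂) (G := G)
    (Fintype.card α) (fun i => max (Fintype.card α - i) 1 * (m + 1) ^ i) Set.univ (by
      refine fun hs => hbig (hs.mono subset_rfl ?_)
      have h₁ := sum_range_sub_mul_pow_le hα
      have h₂ : (m + 1) ^ Fintype.card α ≤ (m + 1) ^ m := Nat.pow_le_pow_right (by omega) hα
      simp only [Nat.sub_self, zero_le, max_eq_right, one_mul]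
      omega)
  let e := Fintype.equivFin α
  obtain ⟨f, hfU, hfR, hlast⟩ := exists_greedy_embedding hα hβ hG (Fintype.card α)
    (fun i j => ∀ a b, (e a : ℕ) = i → (e b : ℕ) = j → H₁.adj a b) U hU hdisj
  refine hlast (IsPart.splits (Or.inr (Or.inr fun hc => hG ?_)))
  obtain ⟨g, hg, hgU, hga⟩ := tContains_induce_iff.1 hc
  have hfg : ∀ a b, G.adj (f (e a)) (g b) := by
    intro a b
    refine ((hgU b).2 (e a) (e a).2).1 fun _ a' _ ha' => ?_
    exact absurd ha' (e a').2.ne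
  have hlt : ∀ a b, e a < e b →
      f (e a) ≠ f (e b) ∧ (H₁.adj a b ↔ G.adj (f (e a)) (f (e b))) := by
    intro a b hab
    refine ⟨(hdisj (e a) (e b) hab (e b).2.le).ne_of_mem (hfU _ (e a).2) (hfU _ (e b).2), ?_⟩
    rw [← hfR (e a) (e b) hab (e b).2]
    refine ⟨fun h a' b' ha hb => ?_, fun h => h a b rfl rfl⟩
    rwa [e.injective (Fin.ext ha), e.injective (Fin.ext hb)]
  have hinj : Function.Injective fun a => f (e a) := by
    intro a b hab
    rcases lt_trichotomy (e a) (e b) with h | h | h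
    · exact absurd hab (hlt a b h).1
    · exact e.injective h
    · exact absurd hab.symm (hlt b a h).1
  have hadj : ∀ a b, H₁.adj a b ↔ G.adj (f (e a)) (f (e b)) := by
    intro a b
    rcases lt_trichotomy (e a) (e b) with h | h | h
    · exact (hlt a b h).2
    · rw [e.injective h]
      exact iff_of_false (H₁.irrefl b) (G.irrefl _)
    · have hne : a ≠ b := by
        rintro rfl
        exact h.false
      rw [H₁.exactlyOne a b hne, G.exactlyOne _ _ (hlt b a h).1.symm, (hlt b a h).2]
  exact tContains_tSeq hinj hg hadj hga hfg

/-- Let `H₁, H₂` be non-null tournaments, `H = H₁ ⇒ H₂`, and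
`m = max(|V(H₁)|,|V(H₂)|)`.  Then every `H`-free tournament admits an
`({H₁,H₂}, 2(m+1)^m)`-partition. -/
theorem stmt12 {α β : Type} [Fintype α] [Fintype β] [Nonempty α] [Nonempty β]
    (H₁ : Tournament α) (H₂ : Tournament β) (m : ℕ)
    (hm : m = max (Fintype.card α) (Fintype.card β)) :
    ∀ (γ : Type) [Fintype γ] (G : Tournament γ),
      ¬ TContains G (TSeq H₁ H₂) →
      HasPartition (2 * (m + 1) ^ m) (fun X : Set γ =>
        ¬ TContains (G.induce X) H₁ ∨ ¬ TContains (G.induce X) H₂) := by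
  intro γ _ G hG
  obtain ⟨c, hc, hp⟩ := splits_univ_of_not_tContains (m := m)
    (hm ▸ le_max_left _ _) (hm ▸ le_max_right _ _) hG
  refine ⟨fun i => {x | c x = i}, ?_, ?_, fun i => ?_⟩
  · exact Set.eq_univ_of_forall fun x => Set.mem_iUnion.2 ⟨⟨c x, hc x trivial⟩, rfl⟩
  · intro i j hij
    exact Set.disjoint_left.2 fun x hi hj => hij (Fin.ext (hi.symm.trans hj))
  · have hi := hp i
    simp only [Set.mem_univ, true_and] at hi
    rcases hi with hi | hi
    · rcases hi.eq_empty_or_singleton with h | h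
      · refine Or.inr (Or.inl fun hcont => ?_)
        obtain ⟨f, -, hf, -⟩ := tContains_induce_iff.1 hcont
        exact h.subset (hf (Classical.arbitrary α))
      · exact Or.inl h
    · exact Or.inr hi
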